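/- For every n ∈ ℕ and every integer t > 2, the number of partitions of n into distinct parts, each of which is either divisible by t or congruent to t−1 or t+1 modulo 2t, equals the number of partitions of n into distinct parts greater than 1, each divisible by t or congruent to ±1 mod t, such that the difference between any two adjacent parts is at least t+1 unless both parts are divisible by t or their sum is divisible by 2t. -/

import Mathlib

/-- `C(n)_t`: partitions of `n` (as finsets of distinct positive parts) whose parts are
divisible by `t` or congruent to `t ± 1 (mod 2t)`. -/
def Cset (n t : ℕ) : Set (Finset ℕ) :=
  {A | (∀ d ∈ A, 0 < d ∧ (t ∣ d ∨ d % (2 * t) = t - 1 ∨ d % (2 * t) = t + 1)) ∧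
       A.sum id = n}

/-- `D(n)_t`: partitions of `n` (as finsets of distinct parts, all `> 1`) whose parts are
divisible by `t` or congruent to `± 1 (mod t)`, and such that any two adjacent parts (in
decreasing order) differ by at least `t + 1` unless both are divisible by `t` or their sum
is divisible by `2t`. -/
def Dset (n t : ℕ) : Set (Finset ℕ) :=
  {A | (∀ d ∈ A, 1 < d ∧ (t ∣ d ∨ d % t = 1 ∨ d % t = t - 1)) ∧
       A.sum id = n ∧
       ∀ a ∈ A, ∀ b ∈ A, b < a → (∀ c ∈ A, ¬ (b < c ∧ c < a)) →
         (t + 1 ≤ a - b ∨ (t ∣ a ∧ t ∣ b) ∨ 2 * t ∣ (a + b))}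

section Recurrence

variable {R : Type*} [CommRing R]

/-- The solution of the third-order recurrence satisfied by the bounded generating functions
of the difference-restricted partitions. -/
def boundedGF (q a b : R) : ℕ → R
  | 0 => 1
  | 1 => 1
  | 2 => (1 + a) * (1 + b) + q
  | n + 3 => (1 + q ^ (n + 2)) * boundedGF q a b (n + 2) +
      q ^ (n + 1) * (a + b + a * b * q ^ (n + 1)) * boundedGF q a b (n + 1) +
      a * b * q ^ (2 * n + 1) * (1 - q ^ (n + 1)) * boundedGF q a b n

theorem boundedGF_add_three (q a b : R) (n : ℕ) :
    boundedGF q a b (n + 3) = (1 + q ^ (n + 2)) * boundedGF q a b (n + 2) +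
      q ^ (n + 1) * (a + b + a * b * q ^ (n + 1)) * boundedGF q a b (n + 1) +
      a * b * q ^ (2 * n + 1) * (1 - q ^ (n + 1)) * boundedGF q a b n := by
  rw [boundedGF]

theorem boundedGF_comm (q a b : R) (n : ℕ) : boundedGF q a b n = boundedGF q b a n := by
  induction n using Nat.strong_induction_on with
  | _ n ih =>
    match n with
    | 0 => simp [boundedGF]
    | 1 => simp [boundedGF]
    | 2 => simp only [boundedGF]; ring
    | n + 3 =>
      rw [boundedGF_add_three, boundedGF_add_three, ih n (by omega), ih (n + 1) (by omega),
        ih (n + 2) (by omega)]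
      ring

theorem one_add_mul_boundedGF (q a b : R) (n : ℕ) :
    (1 + b * q) * boundedGF q a b (n + 3) =
      boundedGF q a (b * q ^ 2) (n + 3) + b * (1 + q) * boundedGF q a (b * q ^ 2) (n + 2) +
      (a * b * (q ^ (n + 2) + q ^ (n + 1) - q ^ (2 * n + 4)) + b ^ 2 * q +
        a * b ^ 2 * q ^ (n + 2)) * boundedGF q a (b * q ^ 2) (n + 1) +
      a * b ^ 2 * q ^ (n + 1) * (1 - q ^ (n + 1)) * boundedGF q a (b * q ^ 2) n := by
  induction n using Nat.strong_induction_on with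
  | _ n ih =>
    match n with
    | 0 => simp only [boundedGF]; ring
    | 1 => simp only [boundedGF]; ring
    | 2 => simp only [boundedGF]; ring
    | n + 3 =>
      have h₀ := ih n (by omega)
      have h₁ := ih (n + 1) (by omega)
      have h₂ := ih (n + 2) (by omega)
      have hs := boundedGF_add_three q a b (n + 3)
      have u₀ := boundedGF_add_three q a (b * q ^ 2) n
      have u₁ := boundedGF_add_three q a (b * q ^ 2) (n + 1)
      have u₂ := boundedGF_add_three q a (b * q ^ 2) (n + 2)
      have u₃ := boundedGF_add_three q a (b * q ^ 2) (n + 3)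
      simp only [add_assoc, Nat.reduceAdd] at h₀ h₁ h₂ hs u₀ u₁ u₂ u₃ ⊢
      linear_combination (1 + b * q) * hs + (1 + q ^ (n + 5)) * h₂ +
        q ^ (n + 4) * (a + b + a * b * q ^ (n + 4)) * h₁ +
        a * b * q ^ (2 * n + 7) * (1 - q ^ (n + 4)) * h₀ - u₃ - b * (1 + q) * u₂ -
        (a * b * (q ^ (n + 5) + q ^ (n + 4) - q ^ (2 * n + 8)) + b ^ 2 * q +
          a * b ^ 2 * q ^ (n + 5)) * u₁ -
        a * b ^ 2 * q ^ (n + 5) * (1 - q ^ (n + 4)) * u₀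

theorem pow_dvd_boundedGF_sub (q a b : R) (n : ℕ) :
    q ^ n ∣ boundedGF q a b (n + 2) - boundedGF q a b (n + 1) := by
  cases n with
  | zero => simp
  | succ n =>
    refine ⟨q * boundedGF q a b (n + 2) + (a + b + a * b * q ^ (n + 1)) * boundedGF q a b (n + 1) +
      a * b * q ^ n * (1 - q ^ (n + 1)) * boundedGF q a b n, ?_⟩
    rw [boundedGF_add_three]
    ring

theorem pow_dvd_boundedGF_sub_one_add_mul (q a b : R) (n : ℕ) :
    q ^ n ∣ boundedGF q a b (n + 3) - (1 + b) * boundedGF q a (b * q ^ 2) (n + 3) := by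
  have hcop : IsCoprime (q ^ n) (1 + b * q) :=
    IsCoprime.pow_left ⟨-b, 1, by ring⟩
  refine hcop.dvd_of_dvd_mul_left ?_
  obtain ⟨x, hx⟩ := pow_dvd_boundedGF_sub q a (b * q ^ 2) n
  obtain ⟨y, hy⟩ := pow_dvd_boundedGF_sub q a (b * q ^ 2) (n + 1)
  refine ⟨-b * (1 + q + b * q) * q * y - b ^ 2 * q * x +
    (a * b * (q ^ 2 + q - q ^ (n + 4)) + a * b ^ 2 * q ^ 2) *
      boundedGF q a (b * q ^ 2) (n + 1) +
    a * b ^ 2 * q * (1 - q ^ (n + 1)) * boundedGF q a (b * q ^ 2) n, ?_⟩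
  linear_combination one_add_mul_boundedGF q a b n - b * (1 + q + b * q) * hy - b ^ 2 * q * hx

theorem pow_dvd_boundedGF_sub_prod (q a b : R) (n M : ℕ) :
    q ^ n ∣ boundedGF q a b (n + 3) -
      (∏ i ∈ Finset.range M, (1 + b * q ^ (2 * i))) *
        boundedGF q a (b * q ^ (2 * M)) (n + 3) := by
  induction M with
  | zero => simp
  | succ M ih =>
    have h := (pow_dvd_boundedGF_sub_one_add_mul q a (b * q ^ (2 * M)) n).mul_left
      (∏ i ∈ Finset.range M, (1 + b * q ^ (2 * i)))
    rw [Finset.prod_range_succ, show b * q ^ (2 * (M + 1)) = b * q ^ (2 * M) * q ^ 2 by ring]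
    convert dvd_add ih h using 1
    ring

theorem dvd_boundedGF_sub_zero {q a b r : R} (ha : r ∣ a) (hb : r ∣ b) (n : ℕ) :
    r ∣ boundedGF q a b n - boundedGF q 0 0 n := by
  obtain ⟨a, rfl⟩ := ha
  obtain ⟨b, rfl⟩ := hb
  induction n using Nat.strong_induction_on with
  | _ n ih =>
    match n with
    | 0 => simp [boundedGF]
    | 1 => simp [boundedGF]
    | 2 => exact ⟨a + b + r * a * b, by simp only [boundedGF]; ring⟩
    | n + 3 =>
      obtain ⟨x, hx⟩ := ih (n + 2) (by omega)
      refine ⟨(1 + q ^ (n + 2)) * x +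
        q ^ (n + 1) * (a + b + r * a * b * q ^ (n + 1)) * boundedGF q (r * a) (r * b) (n + 1) +
        a * r * b * q ^ (2 * n + 1) * (1 - q ^ (n + 1)) * boundedGF q (r * a) (r * b) n, ?_⟩
      rw [boundedGF_add_three, boundedGF_add_three]
      linear_combination (1 + q ^ (n + 2)) * hx

theorem boundedGF_zero_zero (q : R) (n : ℕ) :
    boundedGF q 0 0 (n + 1) = ∏ k ∈ Finset.range n, (1 + q ^ (k + 1)) := by
  induction n with
  | zero => simp [boundedGF]
  | succ n ih =>
    rw [Finset.prod_range_succ, ← ih]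
    cases n with
    | zero => simp [boundedGF]
    | succ n => rw [boundedGF_add_three]; ring

/-- The bounded generating functions converge `q`-adically to an infinite product. -/
theorem pow_dvd_boundedGF_sub_prod_mul_prod (q a b : R) (M : ℕ) :
    q ^ (2 * M) ∣ boundedGF q a b (2 * M + 3) -
      (∏ i ∈ Finset.range M, (1 + a * q ^ (2 * i))) *
        (∏ i ∈ Finset.range M, (1 + b * q ^ (2 * i))) *
        ∏ k ∈ Finset.range (2 * M + 2), (1 + q ^ (k + 1)) := by
  have h₁ := pow_dvd_boundedGF_sub_prod q a b (2 * M) M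
  have h₂ := (pow_dvd_boundedGF_sub_prod q (b * q ^ (2 * M)) a (2 * M) M).mul_left
    (∏ i ∈ Finset.range M, (1 + b * q ^ (2 * i)))
  have h₃ := (dvd_boundedGF_sub_zero (q := q) (dvd_mul_left (q ^ (2 * M)) b)
    (dvd_mul_left (q ^ (2 * M)) a) (2 * M + 3)).mul_left
    ((∏ i ∈ Finset.range M, (1 + a * q ^ (2 * i))) *
      ∏ i ∈ Finset.range M, (1 + b * q ^ (2 * i)))
  rw [boundedGF_zero_zero] at h₃
  rw [boundedGF_comm q (b * q ^ (2 * M)) a] at h₂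
  convert dvd_add (dvd_add h₁ h₂) h₃ using 1
  ring

/-- Eliminating the auxiliary sequence `v` from the system of recurrences satisfied by the
generating functions `u` and `v` leads to `boundedGF`. -/
theorem eq_boundedGF {q a b : R} {u v : ℕ → R} (hu₀ : u 0 = 1) (hu₁ : u 1 = 1) (hv₀ : v 0 = 1)
    (hv : ∀ n, v (n + 1) = u (n + 1) + a * q ^ n * u n + q ^ (n + 1) * v n)
    (hu : ∀ n, u (n + 2) = v (n + 1) + b * q ^ n * (v n + a * q ^ n * u n)) (n : ℕ) :
    u n = boundedGF q a b n := by
  induction n using Nat.strong_induction_on with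
  | _ n ih =>
    match n with
    | 0 => simp [boundedGF, hu₀]
    | 1 => simp [boundedGF, hu₁]
    | 2 =>
      simp only [boundedGF, hu 0, hv 0, hu₀, hu₁, hv₀, zero_add]
      ring
    | n + 3 =>
      rw [boundedGF_add_three, ← ih n (by omega), ← ih (n + 1) (by omega), ← ih (n + 2) (by omega)]
      have e₁ := hv n
      have e₂ := hv (n + 1)
      have e₃ := hu n
      have e₄ := hu (n + 1)
      simp only [add_assoc, Nat.reduceAdd] at e₁ e₂ e₃ e₄ ⊢
      linear_combination e₄ + e₂ + b * q ^ (n + 1) * e₁ - q ^ (n + 2) * e₃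

end Recurrence

section SubsetGF

open Polynomial

/-- The generating function by sum of the finsets in `S`. -/
noncomputable def sumGF (S : Finset (Finset ℕ)) : ℤ[X] :=
  ∑ A ∈ S, X ^ A.sum id

theorem coeff_sumGF (S : Finset (Finset ℕ)) (n : ℕ) :
    (sumGF S).coeff n = (S.filter fun A => A.sum id = n).card := by
  simp only [sumGF, finsetSum_coeff, coeff_X_pow, Finset.card_filter, Nat.cast_sum, Nat.cast_ite,
    Nat.cast_one, Nat.cast_zero, eq_comm]

theorem sumGF_powerset (P : Finset ℕ) : sumGF P.powerset = ∏ d ∈ P, (1 + X ^ d) := by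
  rw [Finset.prod_one_add, sumGF]
  exact Finset.sum_congr rfl fun A _ => (Finset.prod_pow_eq_pow_sum A id X).symm

open scoped Classical in
/-- The generating function by sum of the subsets of `{0, …, m - 1}` satisfying `P`. -/
noncomputable def subsetGF (P : Finset ℕ → Prop) (m : ℕ) : ℤ[X] :=
  sumGF ((Finset.range m).powerset.filter P)

theorem subsetGF_congr {P Q : Finset ℕ → Prop} {m : ℕ}
    (h : ∀ A, (∀ y ∈ A, y < m) → (P A ↔ Q A)) : subsetGF P m = subsetGF Q m := by
  classical
  unfold subsetGF
  congr 1
  refine Finset.filter_congr fun A hA => h A fun y hy => ?_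
  exact Finset.mem_range.1 (Finset.mem_powerset.1 hA hy)

theorem subsetGF_eq_of_le {P : Finset ℕ → Prop} {m k : ℕ} (hmk : m ≤ k)
    (h : ∀ A, (∀ y ∈ A, y < k) → P A → ∀ y ∈ A, y < m) : subsetGF P k = subsetGF P m := by
  classical
  unfold subsetGF
  congr 1
  ext A
  simp only [Finset.mem_filter, Finset.mem_powerset, Finset.subset_iff, Finset.mem_range]
  exact ⟨fun ⟨h₁, h₂⟩ => ⟨fun y hy => h A (fun _ hz => h₁ hz) h₂ y hy, h₂⟩,
    fun ⟨h₁, h₂⟩ => ⟨fun y hy => (h₁ hy).trans_le hmk, h₂⟩⟩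

theorem subsetGF_succ (P : Finset ℕ → Prop) (m : ℕ) :
    subsetGF P (m + 1) = subsetGF P m + X ^ m * subsetGF (fun A => P (insert m A)) m := by
  classical
  simp only [subsetGF, sumGF, Finset.sum_filter]
  rw [Finset.range_add_one, Finset.sum_powerset_insert Finset.notMem_range_self, Finset.mul_sum]
  congr 1
  refine Finset.sum_congr rfl fun A hA => ?_
  have hm : m ∉ A := fun h => Finset.notMem_range_self (Finset.mem_powerset.1 hA h)
  split_ifs
  · rw [Finset.sum_insert hm, id, pow_add]
  · simp

theorem subsetGF_zero {P : Finset ℕ → Prop} (h : P ∅) : subsetGF P 0 = 1 := by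
  classical
  simp [subsetGF, sumGF, Finset.filter_singleton, h]

end SubsetGF

section Difference

/-- The parts allowed in the difference-restricted partitions. -/
def IsDPart (t d : ℕ) : Prop :=
  1 < d ∧ (t ∣ d ∨ d % t = 1 ∨ d % t = t - 1)

/-- The condition on adjacent parts `y < x` of the difference-restricted partitions. -/
def DRel (t x y : ℕ) : Prop :=
  t + 1 ≤ x - y ∨ (t ∣ x ∧ t ∣ y) ∨ 2 * t ∣ (x + y)

/-- The difference-restricted partitions. -/
def IsDPartition (t : ℕ) (A : Finset ℕ) : Prop :=
  (∀ d ∈ A, IsDPart t d) ∧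
    ∀ a ∈ A, ∀ b ∈ A, b < a → (∀ c ∈ A, ¬ (b < c ∧ c < a)) → DRel t a b

theorem isDPartition_empty (t : ℕ) : IsDPartition t ∅ := by
  simp [IsDPartition]

theorem isDPartition_insert_iff {t x : ℕ} {A : Finset ℕ} (hA : ∀ y ∈ A, y < x) :
    IsDPartition t (insert x A) ↔
      IsDPart t x ∧ IsDPartition t A ∧ ∀ y ∈ A, (∀ c ∈ A, c ≤ y) → DRel t x y := by
  constructor
  · rintro ⟨h₁, h₂⟩
    refine ⟨h₁ x (Finset.mem_insert_self _ _),
      ⟨fun d hd => h₁ d (Finset.mem_insert_of_mem hd), fun a ha b hb hba hc => ?_⟩,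
      fun y hy hmax => ?_⟩
    · refine h₂ a (Finset.mem_insert_of_mem ha) b (Finset.mem_insert_of_mem hb) hba fun c hcA => ?_
      rcases Finset.mem_insert.1 hcA with rfl | hcA
      · have := hA a ha
        omega
      · exact hc c hcA
    · refine h₂ x (Finset.mem_insert_self _ _) y (Finset.mem_insert_of_mem hy) (hA y hy)
        fun c hcA => ?_
      rcases Finset.mem_insert.1 hcA with rfl | hcA
      · omega
      · have := hmax c hcA
        omega
  · rintro ⟨hx, ⟨h₁, h₂⟩, h₃⟩
    refine ⟨fun d hd => ?_, fun a ha b hb hba hc => ?_⟩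
    · rcases Finset.mem_insert.1 hd with rfl | hd
      exacts [hx, h₁ d hd]
    · rcases Finset.mem_insert.1 ha with rfl | haA
      · rcases Finset.mem_insert.1 hb with rfl | hb
        · omega
        · refine h₃ b hb fun c hcA => ?_
          have := hc c (Finset.mem_insert_of_mem hcA)
          have := hA c hcA
          omega
      · rcases Finset.mem_insert.1 hb with rfl | hb
        · exact absurd (hA a haA) hba.not_gt
        · exact h₂ a haA b hb hba fun c hcA => hc c (Finset.mem_insert_of_mem hcA)

theorem forall_lt_of_isDPartition_insert {t x k m : ℕ} {A : Finset ℕ} (hkx : k ≤ x)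
    (hrel : ∀ y < k, IsDPart t y → DRel t x y → y < m) (hA : ∀ y ∈ A, y < k)
    (h : IsDPartition t (insert x A)) : ∀ y ∈ A, y < m := by
  intro y hy
  obtain ⟨-, hD, hmax⟩ :=
    (isDPartition_insert_iff fun y hy => (hA y hy).trans_le hkx).1 h
  have hne : A.Nonempty := ⟨y, hy⟩
  have hmem := A.max'_mem hne
  exact (A.le_max' y hy).trans_lt
    (hrel _ (hA _ hmem) (hD.1 _ hmem) (hmax _ hmem fun c hc => A.le_max' c hc))

/-- The subsets of `{0, …, k - 1}` that form a difference-restricted partition when `x` is added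
are those contained in `{0, …, m - 1}`, if `m` separates the parts compatible with `x`. -/
theorem subsetGF_insert_eq {t x k m : ℕ} (hx : IsDPart t x) (hmk : m ≤ k) (hkx : k ≤ x)
    (hrel : ∀ y < k, IsDPart t y → (DRel t x y ↔ y < m)) :
    subsetGF (fun A => IsDPartition t (insert x A)) k = subsetGF (IsDPartition t) m := by
  rw [subsetGF_eq_of_le hmk fun A hA h => forall_lt_of_isDPartition_insert hkx
    (fun y hy hp => (hrel y hy hp).1) hA h]
  refine subsetGF_congr fun A hA => ?_
  rw [isDPartition_insert_iff fun y hy => (hA y hy).trans_le (hmk.trans hkx)]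
  exact ⟨fun h => h.2.1, fun h => ⟨hx, h, fun y hy _ =>
    (hrel y ((hA y hy).trans_le hmk) (h.1 y hy)).2 (hA y hy)⟩⟩

theorem subsetGF_insert_eq_add {t x z m : ℕ} (hx : IsDPart t x) (hz : IsDPart t z) (hmz : m ≤ z)
    (hzx : z < x) (hrel : ∀ y < x, IsDPart t y → (DRel t x y ↔ y < m ∨ y = z)) :
    subsetGF (fun A => IsDPartition t (insert x A)) x = subsetGF (IsDPartition t) m +
      Polynomial.X ^ z * subsetGF (fun A => IsDPartition t (insert z A)) z := by
  rw [subsetGF_eq_of_le (m := z + 1) hzx fun A hA h => forall_lt_of_isDPartition_insert le_rfl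
    (fun y hy hp hr => by have := (hrel y hy hp).1 hr; omega) hA h, subsetGF_succ,
    subsetGF_insert_eq hx hmz hzx.le fun y hy hp => by rw [hrel y (hy.trans hzx) hp]; omega]
  congr 2
  refine subsetGF_congr fun A hA => ?_
  rw [isDPartition_insert_iff]
  · refine ⟨fun h => h.2.1, fun h => ⟨hx, h, fun y hy hmax => ?_⟩⟩
    have hzy := hmax z (Finset.mem_insert_self _ _)
    have hyz : y ≤ z := by
      rcases Finset.mem_insert.1 hy with rfl | hy
      exacts [le_rfl, (hA y hy).le]
    rw [le_antisymm hyz hzy]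
    exact (hrel z hzx hz).2 (Or.inr rfl)
  · intro y hy
    rcases Finset.mem_insert.1 hy with rfl | hy
    exacts [hzx, (hA y hy).trans hzx]

theorem IsDPart.eq_of_lt {t n y : ℕ} (h : IsDPart t y) (h₁ : t * n ≤ y) (h₂ : y < t * n + t) :
    y = t * n ∨ y = t * n + 1 ∨ y + 1 = t * n + t := by
  obtain ⟨r, rfl⟩ := Nat.exists_eq_add_of_le h₁
  have hr : r < t := by omega
  have h' := h.2
  rw [Nat.dvd_iff_mod_eq_zero, Nat.mul_add_mod, Nat.mod_eq_of_lt hr] at h'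
  omega

theorem isDPart_of_add_one_eq {t n x : ℕ} (ht : 2 < t) (hx : x + 1 = t * n + t) :
    IsDPart t x := by
  obtain rfl : x = t * n + (t - 1) := by omega
  refine ⟨by omega, Or.inr (Or.inr ?_)⟩
  rw [Nat.mul_add_mod, Nat.mod_eq_of_lt (by omega)]

theorem isDPart_mul {t : ℕ} (n : ℕ) (ht : 1 < t) : IsDPart t (t * n + t) :=
  ⟨by omega, Or.inl ⟨n + 1, by ring⟩⟩

theorem isDPart_mul_add_one {t : ℕ} (n : ℕ) (ht : 2 < t) : IsDPart t (t * n + t + 1) := by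
  refine ⟨by omega, Or.inr (Or.inl ?_)⟩
  rw [show t * n + t + 1 = t * (n + 1) + 1 by ring, Nat.mul_add_mod, Nat.mod_eq_of_lt (by omega)]

theorem not_dvd_mul_add {t n r : ℕ} (hr : 0 < r) (hrt : r < t) : ¬ t ∣ t * n + r :=
  Nat.not_dvd_of_lt_of_lt_mul_succ (k := n) (by omega) (by rw [mul_add]; omega)

theorem dRel_pred_mul_iff {t n x y : ℕ} (ht : 2 < t) (hx : x + 1 = t * n + t) (hyx : y < x)
    (hy : IsDPart t y) : DRel t x y ↔ y < t * n - 1 := by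
  have hy₁ := hy.1
  constructor
  · intro h
    by_contra hlt
    have htx : ¬ t ∣ x := by
      obtain rfl : x = t * n + (t - 1) := by omega
      exact not_dvd_mul_add (by omega) (by omega)
    have hsum : ¬ 2 * t ∣ x + y := by
      have h2 : 2 * t * n = 2 * (t * n) := by ring
      rcases Nat.lt_or_ge y (t * n) with hlt' | hge
      · rw [show x + y = 2 * t * n + (t - 2) by omega]
        exact not_dvd_mul_add (by omega) (by omega)
      · rcases hy.eq_of_lt hge (by omega) with rfl | rfl | h'
        · rw [show x + t * n = 2 * t * n + (t - 1) by omega]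
          exact not_dvd_mul_add (by omega) (by omega)
        · rw [show x + (t * n + 1) = 2 * t * n + t by omega]
          exact not_dvd_mul_add (by omega) (by omega)
        · omega
    rcases h with h | h | h
    · omega
    · exact htx h.1
    · exact hsum h
  · intro h
    left
    omega

theorem dRel_mul_iff {t n y : ℕ} (ht : 2 < t) (hyx : y < t * n + t) (hy : IsDPart t y) :
    DRel t (t * n + t) y ↔ y < t * n + 1 := by
  have h2 : 2 * t * n = 2 * (t * n) := by ring
  constructor
  · intro h
    by_contra hlt
    obtain ⟨r, hr, hr₀⟩ : ∃ r, y = t * n + r ∧ (r = 1 ∨ r = t - 1) := by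
      refine ⟨y - t * n, by omega, ?_⟩
      have := hy.eq_of_lt (n := n) (by omega) (by omega)
      omega
    rcases h with h | h | h
    · omega
    · rw [hr] at h
      exact not_dvd_mul_add (by omega) (by omega) h.2
    · rw [show t * n + t + y = 2 * t * n + (t + r) by omega] at h
      exact not_dvd_mul_add (by omega) (by omega) h
  · intro h
    rcases Nat.lt_or_ge y (t * n) with hlt | hge
    · left
      omega
    · obtain rfl : y = t * n := by omega
      exact Or.inr (Or.inl ⟨⟨n + 1, by ring⟩, ⟨n, rfl⟩⟩)

theorem dRel_succ_mul_iff {t n y z : ℕ} (ht : 2 < t) (hz : z + 1 = t * n + t)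
    (hyx : y < t * n + t + 1) (hy : IsDPart t y) :
    DRel t (t * n + t + 1) y ↔ y < t * n + 1 ∨ y = z := by
  have h2 : 2 * t * n = 2 * (t * n) := by ring
  have htx : ¬ t ∣ t * n + t + 1 := by
    rw [show t * n + t + 1 = t * (n + 1) + 1 by ring]
    exact not_dvd_mul_add (by omega) (by omega)
  constructor
  · intro h
    by_contra hlt
    rcases h with h | h | h
    · omega
    · exact htx h.1
    · rcases Nat.lt_or_ge y (t * n + t) with hlt' | hge
      · have := hy.eq_of_lt (n := n) (by omega) (by omega)
        rw [show t * n + t + 1 + y = 2 * t * n + (t + 2) by omega] at h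
        exact not_dvd_mul_add (by omega) (by omega) h
      · rw [show t * n + t + 1 + y = 2 * t * (n + 1) + 1 by rw [mul_add]; omega] at h
        exact not_dvd_mul_add (by omega) (by omega) h
  · rintro (h | rfl)
    · left
      omega
    · exact Or.inr (Or.inr ⟨n + 1, by rw [mul_add]; omega⟩)

open Polynomial

/-- The generating function of the difference-restricted partitions with parts below `m`. -/
noncomputable def dGF (t m : ℕ) : ℤ[X] :=
  subsetGF (IsDPartition t) m

theorem dGF_eq_of_not_isDPart {t m k : ℕ} (hmk : m ≤ k)
    (h : ∀ y, m ≤ y → y < k → ¬ IsDPart t y) : dGF t k = dGF t m := by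
  refine subsetGF_eq_of_le hmk fun A hA hD y hy => ?_
  by_contra hlt
  exact h y (by omega) (hA y hy) (hD.1 y hy)

theorem dGF_eq_one {t m : ℕ} (hm : m < t) : dGF t m = 1 := by
  rw [dGF_eq_of_not_isDPart (Nat.zero_le m) fun y _ hy hp => ?_]
  · exact subsetGF_zero (isDPartition_empty t)
  · have := hp.eq_of_lt (n := 0) (by omega) (by omega)
    have := hp.1
    omega

theorem dGF_mul_add_one {t : ℕ} (ht : 2 < t) (n : ℕ) :
    dGF t (t * (n + 1) + 1) = dGF t (t * (n + 1) - 1) +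
      X ^ (t - 1) * (X ^ t) ^ n * dGF t (t * n - 1) + (X ^ t) ^ (n + 1) * dGF t (t * n + 1) := by
  have e : t * (n + 1) = t * n + t := by ring
  obtain ⟨x, hx⟩ : ∃ x, x + 1 = t * n + t := ⟨t * n + t - 1, by omega⟩
  have hX : (X ^ (t - 1) * (X ^ t) ^ n : ℤ[X]) = X ^ x := by
    rw [← pow_mul, ← pow_add]
    congr 1
    omega
  rw [hX, ← pow_mul, e, ← hx, Nat.add_sub_cancel, hx]
  unfold dGF
  rw [subsetGF_succ, subsetGF_insert_eq (m := t * n + 1) (isDPart_mul n (by omega)) (by omega) le_rfl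
    fun y hy hp => dRel_mul_iff ht hy hp, ← hx, subsetGF_succ,
    subsetGF_insert_eq (m := t * n - 1) (isDPart_of_add_one_eq ht hx) (by omega) le_rfl
    fun y hy hp => dRel_pred_mul_iff ht hx hy hp]

theorem dGF_mul_sub_one {t : ℕ} (ht : 2 < t) (n : ℕ) :
    dGF t (t * (n + 2) - 1) = dGF t (t * (n + 1) + 1) +
      X ^ (t + 1) * (X ^ t) ^ n *
        (dGF t (t * n + 1) + X ^ (t - 1) * (X ^ t) ^ n * dGF t (t * n - 1)) := by
  have e : t * (n + 1) = t * n + t := by ring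
  have e' : t * (n + 2) = t * n + t + t := by ring
  obtain ⟨x, hx⟩ : ∃ x, x + 1 = t * n + t := ⟨t * n + t - 1, by omega⟩
  have hX : (X ^ (t - 1) * (X ^ t) ^ n : ℤ[X]) = X ^ x := by
    rw [← pow_mul, ← pow_add]
    congr 1
    omega
  have hX' : (X ^ (t + 1) * (X ^ t) ^ n : ℤ[X]) = X ^ (t * n + t + 1) := by
    rw [← pow_mul, ← pow_add]
    congr 1
    omega
  rw [dGF_eq_of_not_isDPart (m := t * n + t + 1 + 1) (by omega) fun y h₁ h₂ hp => by
    have := hp.eq_of_lt (n := n + 1) (by omega) (by omega)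
    omega, hX, hX', e]
  unfold dGF
  rw [subsetGF_succ, subsetGF_insert_eq_add (m := t * n + 1) (isDPart_mul_add_one n ht)
    (isDPart_of_add_one_eq ht hx) (by omega) (by omega)
    fun y hy hp => dRel_succ_mul_iff ht hx hy hp,
    subsetGF_insert_eq (m := t * n - 1) (isDPart_of_add_one_eq ht hx) (by omega) le_rfl
    fun y hy hp => dRel_pred_mul_iff ht hx hy hp]

theorem dGF_eq_boundedGF {t : ℕ} (ht : 2 < t) (n : ℕ) :
    dGF t (t * n - 1) = boundedGF (X ^ t) (X ^ (t - 1)) (X ^ (t + 1)) n :=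
  eq_boundedGF (u := fun n => dGF t (t * n - 1)) (v := fun n => dGF t (t * n + 1))
    (dGF_eq_one (by omega)) (dGF_eq_one (by omega)) (dGF_eq_one (by omega))
    (dGF_mul_add_one ht) (dGF_mul_sub_one ht) n

theorem Dset_ncard_eq_coeff {n t m : ℕ} (hm : n < m) :
    ((Dset n t).ncard : ℤ) = (dGF t m).coeff n := by
  classical
  rw [dGF, subsetGF, coeff_sumGF, Nat.cast_inj, ← Set.ncard_coe_finset]
  congr 1
  ext A
  simp only [Finset.coe_filter, Finset.mem_filter, Finset.mem_powerset, Finset.subset_iff,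
    Finset.mem_range, Set.mem_ofPred_eq]
  constructor
  · rintro ⟨h₁, h₂, h₃⟩
    refine ⟨⟨fun y hy => ?_, h₁, h₃⟩, h₂⟩
    have := Finset.single_le_sum (f := id) (fun _ _ => Nat.zero_le _) hy
    rw [h₂, id] at this
    omega
  · rintro ⟨⟨-, h₁, h₃⟩, h₂⟩
    exact ⟨h₁, h₂, h₃⟩

end Difference

section Congruence

open Polynomial

/-- The parts allowed in the congruence-restricted partitions, up to a bound. -/
def cParts (t M L : ℕ) : Finset ℕ :=
  ((Finset.range M).image fun i => t - 1 + t * (2 * i)) ∪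
    ((Finset.range M).image fun i => t + 1 + t * (2 * i)) ∪
    (Finset.range L).image fun k => t * (k + 1)

theorem pred_add_mul_mod_two_mul {t : ℕ} (ht : 2 < t) (i : ℕ) :
    (t - 1 + t * (2 * i)) % (2 * t) = t - 1 := by
  rw [show t * (2 * i) = 2 * t * i by ring, Nat.add_mul_mod_self_left, Nat.mod_eq_of_lt (by omega)]

theorem succ_add_mul_mod_two_mul {t : ℕ} (ht : 2 < t) (i : ℕ) :
    (t + 1 + t * (2 * i)) % (2 * t) = t + 1 := by
  rw [show t * (2 * i) = 2 * t * i by ring, Nat.add_mul_mod_self_left, Nat.mod_eq_of_lt (by omega)]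

theorem prod_cParts {t : ℕ} (ht : 2 < t) (M L : ℕ) :
    ∏ d ∈ cParts t M L, (1 + X ^ d : ℤ[X]) =
      (∏ i ∈ Finset.range M, (1 + X ^ (t - 1) * (X ^ t) ^ (2 * i))) *
        (∏ i ∈ Finset.range M, (1 + X ^ (t + 1) * (X ^ t) ^ (2 * i))) *
        ∏ k ∈ Finset.range L, (1 + (X ^ t) ^ (k + 1)) := by
  have ht₀ : 0 < t := by omega
  rw [cParts, Finset.prod_union, Finset.prod_union, Finset.prod_image, Finset.prod_image,
    Finset.prod_image]
  · simp only [← pow_mul, ← pow_add]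
  · intro i _ j _ h
    simpa [ht₀.ne'] using h
  · intro i _ j _ h
    simpa [ht₀.ne'] using h
  · intro i _ j _ h
    simpa [ht₀.ne'] using h
  · rw [Finset.disjoint_left]
    rintro _ hx hy
    obtain ⟨i, -, rfl⟩ := Finset.mem_image.1 hx
    obtain ⟨j, -, hj⟩ := Finset.mem_image.1 hy
    have := pred_add_mul_mod_two_mul ht i
    rw [← hj, succ_add_mul_mod_two_mul ht j] at this
    omega
  · rw [Finset.disjoint_left]
    rintro x hx hy
    obtain ⟨j, -, rfl⟩ := Finset.mem_image.1 hy
    simp only [Finset.mem_union, Finset.mem_image] at hx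
    rcases hx with ⟨i, -, hi⟩ | ⟨i, -, hi⟩
    · refine not_dvd_mul_add (t := t) (n := 2 * i) (r := t - 1) (by omega) (by omega) ?_
      rw [add_comm, hi]
      exact dvd_mul_right _ _
    · refine not_dvd_mul_add (t := t) (n := 2 * i + 1) (r := 1) (by omega) (by omega) ?_
      rw [show t * (2 * i + 1) + 1 = t + 1 + t * (2 * i) by ring, hi]
      exact dvd_mul_right _ _

theorem Cset_ncard_eq_coeff {n t M L : ℕ} (ht : 2 < t) (hM : n < M) (hL : n < L) :
    ((Cset n t).ncard : ℤ) = (∏ d ∈ cParts t M L, (1 + X ^ d : ℤ[X])).coeff n := by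
  rw [← sumGF_powerset, coeff_sumGF, Nat.cast_inj, ← Set.ncard_coe_finset]
  congr 1
  ext A
  simp only [Finset.coe_filter, Finset.mem_powerset, Set.mem_ofPred_eq]
  refine and_congr_left fun hsum => ⟨fun h d hd => ?_, fun h d hd => ?_⟩
  · have hdn := Finset.single_le_sum (f := id) (fun _ _ => Nat.zero_le _) hd
    rw [hsum, id] at hdn
    obtain ⟨hd₀, hdiv | hmod | hmod⟩ := h d hd
    · obtain ⟨k, rfl⟩ := hdiv
      have hk : 0 < k := Nat.pos_of_mul_pos_left hd₀
      have hkt : k ≤ t * k := Nat.le_mul_of_pos_left k (by omega)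
      refine Finset.mem_union_right _ (Finset.mem_image.2 ⟨k - 1, Finset.mem_range.2 (by omega), ?_⟩)
      rw [Nat.sub_add_cancel hk]
    all_goals
      have hdm := Nat.mod_add_div d (2 * t)
      have hle : d / (2 * t) ≤ d := Nat.div_le_self _ _
      rw [hmod, show 2 * t * (d / (2 * t)) = t * (2 * (d / (2 * t))) by ring] at hdm
      refine Finset.mem_union_left _ ?_
    · exact Finset.mem_union_left _
        (Finset.mem_image.2 ⟨d / (2 * t), Finset.mem_range.2 (by omega), hdm⟩)
    · exact Finset.mem_union_right _
        (Finset.mem_image.2 ⟨d / (2 * t), Finset.mem_range.2 (by omega), hdm⟩)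
  · have hd' := h hd
    simp only [cParts, Finset.mem_union, Finset.mem_image] at hd'
    rcases hd' with (⟨i, -, rfl⟩ | ⟨i, -, rfl⟩) | ⟨k, -, rfl⟩
    · exact ⟨by omega, Or.inr (Or.inl (pred_add_mul_mod_two_mul ht i))⟩
    · exact ⟨by omega, Or.inr (Or.inr (succ_add_mul_mod_two_mul ht i))⟩
    · exact ⟨Nat.mul_pos (by omega) k.succ_pos, Or.inl (dvd_mul_right _ _)⟩

end Congruence

/-- For every `n` and every `t > 2`, the sets `C(n)_t` and `D(n)_t` have the same
cardinality (Alladi–Andrews–Gordon). -/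
theorem stmt_1 (n t : ℕ) (ht : 2 < t) : (Cset n t).ncard = (Dset n t).ncard := by
  have h := pow_dvd_boundedGF_sub_prod_mul_prod (Polynomial.X ^ t : Polynomial ℤ)
    (Polynomial.X ^ (t - 1)) (Polynomial.X ^ (t + 1)) (n + 1)
  rw [← prod_cParts ht, ← dGF_eq_boundedGF ht, ← pow_mul, Polynomial.X_pow_dvd_iff] at h
  have hn := h n (by nlinarith)
  rw [Polynomial.coeff_sub, ← Cset_ncard_eq_coeff ht (by omega) (by omega),
    ← Dset_ncard_eq_coeff (by
      have : 1 * (2 * (n + 1) + 3) ≤ t * (2 * (n + 1) + 3) := Nat.mul_le_mul_right _ (by omega)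
      omega)] at hn
  omega
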